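/- Let g be a Lie bialgebra (i.e., g is a Lie algebra and δ: g → Λ²g is a Lie cobracket satisfying the compatibility condition). Then ∂(ξ∧dY) - (∂ξ)∧dY - (-1)^p ξ∧∂dY = dσ(Y)ξ - σ(Y)dξ for all ξ ∈ Λ^p g and Y ∈ g. -/

import Mathlib

open TensorProduct

/-- The wedge product `X₁ ∧ ⋯ ∧ X_p` of a list of vectors. -/
noncomputable def wedgeList (g : Type) [AddCommGroup g] [Module ℚ g] (l : List g) :
    ExteriorAlgebra ℚ g := (l.map (ExteriorAlgebra.ι ℚ)).prod

/-- The map `g ⊗ g → Λ* g`, `X ⊗ Y ↦ ι X * ι Y`. -/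
noncomputable def toExt (g : Type) [AddCommGroup g] [Module ℚ g] :
    g ⊗[ℚ] g →ₗ[ℚ] ExteriorAlgebra ℚ g :=
  TensorProduct.lift ((LinearMap.mul ℚ (ExteriorAlgebra ℚ g)).compl₁₂
    (ExteriorAlgebra.ι ℚ) (ExteriorAlgebra.ι ℚ))

/-- The cyclic permutation `(123)` on `g ⊗ g ⊗ g`. -/
noncomputable def cycL (g : Type) [AddCommGroup g] [Module ℚ g] :
    (g ⊗[ℚ] g) ⊗[ℚ] g →ₗ[ℚ] (g ⊗[ℚ] g) ⊗[ℚ] g :=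
  (TensorProduct.comm ℚ g (g ⊗[ℚ] g)).toLinearMap ∘ₗ (TensorProduct.assoc ℚ g g g).toLinearMap

/-- The diagonal adjoint action `σ(Y)` on `g ⊗ g`. -/
noncomputable def sig2 (g : Type) [LieRing g] [LieAlgebra ℚ g] (Y : g) :
    g ⊗[ℚ] g →ₗ[ℚ] g ⊗[ℚ] g :=
  TensorProduct.map (LieAlgebra.ad ℚ g Y) LinearMap.id +
    TensorProduct.map LinearMap.id (LieAlgebra.ad ℚ g Y)

section Wedge

variable {g : Type} [AddCommGroup g] [Module ℚ g]

theorem wedgeList_cons (x : g) (l : List g) :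
    wedgeList g (x :: l) = ExteriorAlgebra.ι ℚ x * wedgeList g l := by
  simp [wedgeList]

theorem ExteriorAlgebra.ι_mul_ι_eq_neg (x y : g) :
    ExteriorAlgebra.ι ℚ x * ExteriorAlgebra.ι ℚ y =
      -(ExteriorAlgebra.ι ℚ y * ExteriorAlgebra.ι ℚ x) :=
  eq_neg_of_add_eq_zero_left (ExteriorAlgebra.ι_add_mul_swap x y)

theorem wedgeList_set (v : g) (l : List g) (k : ℕ) (hk : k < l.length) :
    wedgeList g (l.set k v) =
      (-1 : ℚ) ^ k • (ExteriorAlgebra.ι ℚ v * wedgeList g (l.eraseIdx k)) := by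
  induction l generalizing k with
  | nil => simp at hk
  | cons x l ih =>
    cases k with
    | zero => simp [wedgeList_cons]
    | succ k =>
      rw [List.set_cons_succ, List.eraseIdx_cons_succ, wedgeList_cons, wedgeList_cons,
        ih k (by simpa using hk), ← mul_assoc, ExteriorAlgebra.ι_mul_ι_eq_neg v x, pow_succ]
      simp [mul_assoc]

theorem toExt_tmul (a b : g) :
    toExt g (a ⊗ₜ b) = ExteriorAlgebra.ι ℚ a * ExteriorAlgebra.ι ℚ b := by
  simp [toExt]

theorem toExt_commute_ι (t : g ⊗[ℚ] g) (x : g) :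
    Commute (toExt g t) (ExteriorAlgebra.ι ℚ x) := by
  induction t with
  | zero => simp
  | add s t hs ht => rw [map_add]; exact hs.add_left ht
  | tmul a b =>
    rw [toExt_tmul, Commute, SemiconjBy, mul_assoc, ExteriorAlgebra.ι_mul_ι_eq_neg b x, mul_neg,
      ← mul_assoc, ExteriorAlgebra.ι_mul_ι_eq_neg a x, neg_mul, neg_neg, mul_assoc]

theorem toExt_commute_wedgeList (t : g ⊗[ℚ] g) (l : List g) :
    Commute (toExt g t) (wedgeList g l) := by
  induction l with
  | nil => simp [wedgeList]
  | cons x l ih => rw [wedgeList_cons]; exact (toExt_commute_ι t x).mul_right ih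

/-- Every linear map out of the exterior algebra is determined by wedges of lists. -/
theorem ExteriorAlgebra.linearMap_ext_wedgeList {M : Type*} [AddCommGroup M] [Module ℚ M]
    {f h : ExteriorAlgebra ℚ g →ₗ[ℚ] M} (H : ∀ l : List g, f (wedgeList g l) = h (wedgeList g l)) :
    f = h := by
  have span_mul (x : g) (ξ : ExteriorAlgebra ℚ g)
      (hξ : ξ ∈ Submodule.span ℚ (Set.range (wedgeList g))) :
      ExteriorAlgebra.ι ℚ x * ξ ∈ Submodule.span ℚ (Set.range (wedgeList g)) := by
    induction hξ using Submodule.span_induction with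
    | mem ξ hξ =>
      obtain ⟨l, rfl⟩ := hξ
      exact Submodule.subset_span ⟨x :: l, wedgeList_cons x l⟩
    | zero => simp
    | add a b _ _ ha hb => rw [mul_add]; exact Submodule.add_mem _ ha hb
    | smul c a _ ha => rw [mul_smul_comm]; exact Submodule.smul_mem _ c ha
  have mul_mem (η : ExteriorAlgebra ℚ g) : ∀ ξ ∈ Submodule.span ℚ (Set.range (wedgeList g)),
      η * ξ ∈ Submodule.span ℚ (Set.range (wedgeList g)) := by
    induction η using ExteriorAlgebra.induction with
    | algebraMap r => intro ξ hξ; rw [← Algebra.smul_def]; exact Submodule.smul_mem _ r hξ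
    | ι x => exact span_mul x
    | mul a b ha hb => intro ξ hξ; rw [mul_assoc]; exact ha _ (hb _ hξ)
    | add a b ha hb =>
      intro ξ hξ; rw [add_mul]; exact Submodule.add_mem _ (ha _ hξ) (hb _ hξ)
  refine LinearMap.ext_on_range (v := wedgeList g) ?_ H
  refine Submodule.eq_top_iff'.2 fun ξ => ?_
  simpa using mul_mem ξ 1 (Submodule.subset_span ⟨[], by simp [wedgeList]⟩)

end Wedge

section Bialgebra

variable {g : Type} [LieRing g] [LieAlgebra ℚ g]

theorem diagonalAction_cons {s : ExteriorAlgebra ℚ g →ₗ[ℚ] ExteriorAlgebra ℚ g} {Y : g}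
    (hs : ∀ (p : ℕ) (X : Fin p → g), s (wedgeList g (List.ofFn X)) =
      ∑ i : Fin p, wedgeList g ((List.ofFn X).set (i : ℕ) ⁅Y, X i⁆))
    (x : g) (ξ : ExteriorAlgebra ℚ g) :
    s (ExteriorAlgebra.ι ℚ x * ξ) =
      ExteriorAlgebra.ι ℚ ⁅Y, x⁆ * ξ + ExteriorAlgebra.ι ℚ x * s ξ := by
  suffices h : s ∘ₗ LinearMap.mulLeft ℚ (ExteriorAlgebra.ι ℚ x) =
      LinearMap.mulLeft ℚ (ExteriorAlgebra.ι ℚ ⁅Y, x⁆) +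
        LinearMap.mulLeft ℚ (ExteriorAlgebra.ι ℚ x) ∘ₗ s from
    LinearMap.congr_fun h ξ
  refine ExteriorAlgebra.linearMap_ext_wedgeList fun l => ?_
  obtain ⟨p, X, rfl⟩ : ∃ (p : ℕ) (X : Fin p → g), l = List.ofFn X :=
    ⟨l.length, l.get, (List.ofFn_get l).symm⟩
  have h := hs (p + 1) (Fin.cons x X)
  simp only [List.ofFn_succ, Fin.cons_zero, Fin.cons_succ, Fin.sum_univ_succ, Fin.val_zero,
    Fin.val_succ, List.set_cons_zero, List.set_cons_succ, wedgeList_cons] at h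
  simp [h, hs]

theorem diagonalAction_mul {s : ExteriorAlgebra ℚ g →ₗ[ℚ] ExteriorAlgebra ℚ g} {Y : g}
    (hs : ∀ (p : ℕ) (X : Fin p → g), s (wedgeList g (List.ofFn X)) =
      ∑ i : Fin p, wedgeList g ((List.ofFn X).set (i : ℕ) ⁅Y, X i⁆))
    (ξ η : ExteriorAlgebra ℚ g) : s (ξ * η) = s ξ * η + ξ * s η := by
  have h1 : s 1 = 0 := by simpa [wedgeList] using hs 0 Fin.elim0
  suffices h : s ∘ₗ LinearMap.mulRight ℚ η =
      LinearMap.mulRight ℚ η ∘ₗ s + LinearMap.mulRight ℚ (s η) from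
    LinearMap.congr_fun h ξ
  refine ExteriorAlgebra.linearMap_ext_wedgeList fun l => ?_
  simp only [LinearMap.comp_apply, LinearMap.add_apply, LinearMap.mulRight_apply]
  induction l with
  | nil => simp [wedgeList, h1]
  | cons x l ih =>
    rw [wedgeList_cons, mul_assoc, diagonalAction_cons hs, ih, diagonalAction_cons hs]
    noncomm_ring

theorem diagonalAction_toExt {s : ExteriorAlgebra ℚ g →ₗ[ℚ] ExteriorAlgebra ℚ g} {Y : g}
    (hs : ∀ (p : ℕ) (X : Fin p → g), s (wedgeList g (List.ofFn X)) =
      ∑ i : Fin p, wedgeList g ((List.ofFn X).set (i : ℕ) ⁅Y, X i⁆))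
    (t : g ⊗[ℚ] g) : s (toExt g t) = toExt g (sig2 g Y t) := by
  have h1 : s 1 = 0 := by simpa [wedgeList] using hs 0 Fin.elim0
  have hι (x : g) : s (ExteriorAlgebra.ι ℚ x) = ExteriorAlgebra.ι ℚ ⁅Y, x⁆ := by
    simpa [h1] using diagonalAction_cons hs x 1
  induction t with
  | zero => simp
  | add a b ha hb => simp [ha, hb]
  | tmul a b => simp [sig2, toExt_tmul, diagonalAction_mul hs, hι]

theorem differential_cons {δ : g →ₗ[ℚ] g ⊗[ℚ] g}
    {d : ExteriorAlgebra ℚ g →ₗ[ℚ] ExteriorAlgebra ℚ g}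
    (hd : ∀ (p : ℕ) (X : Fin p → g), d (wedgeList g (List.ofFn X)) =
      ∑ i : Fin p, ((-1 : ℚ) ^ ((i : ℕ) + 1)) •
        (toExt g (δ (X i)) * wedgeList g ((List.ofFn X).eraseIdx (i : ℕ))))
    (x : g) (ξ : ExteriorAlgebra ℚ g) :
    d (ExteriorAlgebra.ι ℚ x * ξ) = -(toExt g (δ x) * ξ) - ExteriorAlgebra.ι ℚ x * d ξ := by
  suffices h : d ∘ₗ LinearMap.mulLeft ℚ (ExteriorAlgebra.ι ℚ x) =
      -LinearMap.mulLeft ℚ (toExt g (δ x)) - LinearMap.mulLeft ℚ (ExteriorAlgebra.ι ℚ x) ∘ₗ d from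
    LinearMap.congr_fun h ξ
  refine ExteriorAlgebra.linearMap_ext_wedgeList fun l => ?_
  obtain ⟨p, X, rfl⟩ : ∃ (p : ℕ) (X : Fin p → g), l = List.ofFn X :=
    ⟨l.length, l.get, (List.ofFn_get l).symm⟩
  have h := hd (p + 1) (Fin.cons x X)
  simp only [List.ofFn_succ, Fin.cons_zero, Fin.cons_succ, Fin.sum_univ_succ, Fin.val_zero,
    Fin.val_succ, List.eraseIdx_cons_zero, List.eraseIdx_cons_succ, wedgeList_cons] at h
  simp only [LinearMap.comp_apply, LinearMap.sub_apply, LinearMap.neg_apply,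
    LinearMap.mulLeft_apply, h, hd, Finset.mul_sum]
  rw [sub_eq_add_neg, ← Finset.sum_neg_distrib]
  refine congrArg₂ (· + ·) (by simp) (Finset.sum_congr rfl fun i _ => ?_)
  rw [← mul_assoc, (toExt_commute_ι _ x).eq, pow_succ _ ((i : ℕ) + 1)]
  simp [mul_assoc]

theorem boundary_cons {pa : ExteriorAlgebra ℚ g →ₗ[ℚ] ExteriorAlgebra ℚ g}
    (hpa : ∀ (p : ℕ) (X : Fin p → g), pa (wedgeList g (List.ofFn X)) =
      ∑ i : Fin p, ∑ j : Fin p, if (i : ℕ) < (j : ℕ) then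
        ((-1 : ℚ) ^ ((i : ℕ) + (j : ℕ))) •
          (ExteriorAlgebra.ι ℚ ⁅X i, X j⁆ *
            wedgeList g (((List.ofFn X).eraseIdx (j : ℕ)).eraseIdx (i : ℕ)))
      else 0)
    {s : ExteriorAlgebra ℚ g →ₗ[ℚ] ExteriorAlgebra ℚ g} {x : g}
    (hs : ∀ (p : ℕ) (X : Fin p → g), s (wedgeList g (List.ofFn X)) =
      ∑ i : Fin p, wedgeList g ((List.ofFn X).set (i : ℕ) ⁅x, X i⁆))
    (ξ : ExteriorAlgebra ℚ g) :
    pa (ExteriorAlgebra.ι ℚ x * ξ) = -s ξ - ExteriorAlgebra.ι ℚ x * pa ξ := by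
  suffices h : pa ∘ₗ LinearMap.mulLeft ℚ (ExteriorAlgebra.ι ℚ x) =
      -s - LinearMap.mulLeft ℚ (ExteriorAlgebra.ι ℚ x) ∘ₗ pa from
    LinearMap.congr_fun h ξ
  refine ExteriorAlgebra.linearMap_ext_wedgeList fun l => ?_
  obtain ⟨p, X, rfl⟩ : ∃ (p : ℕ) (X : Fin p → g), l = List.ofFn X :=
    ⟨l.length, l.get, (List.ofFn_get l).symm⟩
  have h := hpa (p + 1) (Fin.cons x X)
  simp only [List.ofFn_succ, Fin.cons_zero, Fin.cons_succ, Fin.sum_univ_succ, Fin.val_zero,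
    Fin.val_succ, List.eraseIdx_cons_zero, List.eraseIdx_cons_succ, wedgeList_cons,
    Nat.succ_pos, Nat.not_lt_zero, if_true, if_false, zero_add,
    add_lt_add_iff_right] at h
  simp only [LinearMap.comp_apply, LinearMap.sub_apply, LinearMap.neg_apply,
    LinearMap.mulLeft_apply, h, hs, hpa, Finset.mul_sum]
  simp only [sub_eq_add_neg, ← Finset.sum_neg_distrib]
  congr 1
  · refine Finset.sum_congr rfl fun i _ => ?_
    rw [wedgeList_set _ _ _ (by simp), pow_succ]
    simp
  · refine Finset.sum_congr rfl fun i _ => Finset.sum_congr rfl fun j _ => ?_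
    split_ifs
    · rw [← mul_assoc, ExteriorAlgebra.ι_mul_ι_eq_neg _ x,
        show (i : ℕ) + 1 + (j + 1) = i + j + 2 by ring, pow_add]
      simp [mul_assoc]
    · simp

end Bialgebra

/-- in a Lie bialgebra `g`, for `ξ ∈ Λ^p g` and `Y ∈ g`,
`∂(ξ∧dY) - (∂ξ)∧dY - (-1)^p ξ∧∂dY = dσ(Y)ξ - σ(Y)dξ`. -/
theorem stmt4 (g : Type) [LieRing g] [LieAlgebra ℚ g]
    (δ : g →ₗ[ℚ] g ⊗[ℚ] g)
    (hcoskew : ∀ X : g, TensorProduct.comm ℚ g g (δ X) = - δ X)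
    (hcoJacobi : (LinearMap.id + cycL g + cycL g ∘ₗ cycL g) ∘ₗ
      TensorProduct.map δ LinearMap.id ∘ₗ δ = 0)
    (hcompat : ∀ X Y : g, δ ⁅X, Y⁆ = sig2 g X (δ Y) - sig2 g Y (δ X))
    (pa d : ExteriorAlgebra ℚ g →ₗ[ℚ] ExteriorAlgebra ℚ g)
    (σE : g → ExteriorAlgebra ℚ g →ₗ[ℚ] ExteriorAlgebra ℚ g)
    (hpa : ∀ (p : ℕ) (X : Fin p → g),
      pa (wedgeList g (List.ofFn X)) =
        ∑ i : Fin p, ∑ j : Fin p, if (i : ℕ) < (j : ℕ) then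
          ((-1 : ℚ) ^ ((i : ℕ) + (j : ℕ))) •
            (ExteriorAlgebra.ι ℚ ⁅X i, X j⁆ *
              wedgeList g (((List.ofFn X).eraseIdx (j : ℕ)).eraseIdx (i : ℕ)))
        else 0)
    (hd : ∀ (p : ℕ) (X : Fin p → g),
      d (wedgeList g (List.ofFn X)) =
        ∑ i : Fin p, ((-1 : ℚ) ^ ((i : ℕ) + 1)) •
          (toExt g (δ (X i)) * wedgeList g ((List.ofFn X).eraseIdx (i : ℕ))))
    (hσ : ∀ (Y : g) (p : ℕ) (X : Fin p → g),
      σE Y (wedgeList g (List.ofFn X)) =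
        ∑ i : Fin p, wedgeList g ((List.ofFn X).set (i : ℕ) ⁅Y, X i⁆)) :
    ∀ (p : ℕ) (X : Fin p → g) (Y : g),
      pa (wedgeList g (List.ofFn X) * d (ExteriorAlgebra.ι ℚ Y)) -
        pa (wedgeList g (List.ofFn X)) * d (ExteriorAlgebra.ι ℚ Y) -
        ((-1 : ℚ) ^ p) • (wedgeList g (List.ofFn X) * pa (d (ExteriorAlgebra.ι ℚ Y))) =
      d (σE Y (wedgeList g (List.ofFn X))) - σE Y (d (wedgeList g (List.ofFn X))) := by
  intro p X Y
  have cobracket (x : g) : toExt g (δ ⁅Y, x⁆) =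
      σE Y (toExt g (δ x)) - σE x (toExt g (δ Y)) := by
    rw [hcompat, map_sub, diagonalAction_toExt (hσ Y), diagonalAction_toExt (hσ x)]
  have pa_one : pa 1 = 0 := by simpa [wedgeList] using hpa 0 Fin.elim0
  have d_one : d 1 = 0 := by simpa [wedgeList] using hd 0 Fin.elim0
  have σ_one : σE Y 1 = 0 := by simpa [wedgeList] using hσ Y 0 Fin.elim0
  have dY : d (ExteriorAlgebra.ι ℚ Y) = -toExt g (δ Y) := by
    simpa [d_one] using differential_cons hd Y 1
  suffices h : ∀ l : List g,
      pa (wedgeList g l * d (ExteriorAlgebra.ι ℚ Y)) -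
        pa (wedgeList g l) * d (ExteriorAlgebra.ι ℚ Y) -
        ((-1 : ℚ) ^ l.length) • (wedgeList g l * pa (d (ExteriorAlgebra.ι ℚ Y))) =
      d (σE Y (wedgeList g l)) - σE Y (d (wedgeList g l)) by
    simpa using h (List.ofFn X)
  intro l
  induction l with
  | nil => simp [wedgeList, pa_one, d_one, σ_one]
  | cons x l ih =>
    have hcomm : toExt g (sig2 g x (δ Y)) * wedgeList g l =
        wedgeList g l * toExt g (sig2 g x (δ Y)) := toExt_commute_wedgeList _ l
    rw [← diagonalAction_toExt (hσ x)] at hcomm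
    calc
      _ = -(wedgeList g l * σE x (d (ExteriorAlgebra.ι ℚ Y))) - ExteriorAlgebra.ι ℚ x *
          (pa (wedgeList g l * d (ExteriorAlgebra.ι ℚ Y)) -
            pa (wedgeList g l) * d (ExteriorAlgebra.ι ℚ Y) -
            ((-1 : ℚ) ^ l.length) • (wedgeList g l * pa (d (ExteriorAlgebra.ι ℚ Y)))) := by
        rw [wedgeList_cons, mul_assoc, boundary_cons hpa (hσ x), boundary_cons hpa (hσ x),
          diagonalAction_mul (hσ x), List.length_cons, pow_succ]
        simp only [mul_neg, mul_one, neg_smul, mul_sub, mul_smul_comm, sub_mul, neg_mul, mul_assoc]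
        abel
      _ = σE x (toExt g (δ Y)) * wedgeList g l - ExteriorAlgebra.ι ℚ x *
          (d (σE Y (wedgeList g l)) - σE Y (d (wedgeList g l))) := by
        rw [ih, dY, map_neg, hcomm, mul_neg, neg_neg]
      _ = _ := by
        rw [wedgeList_cons, diagonalAction_cons (hσ Y), map_add, differential_cons hd,
          differential_cons hd, differential_cons hd, map_sub, map_neg,
          diagonalAction_mul (hσ Y), diagonalAction_cons (hσ Y), cobracket]
        noncomm_ring
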